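/- Let X be a C*-correspondence over A and I₁, I₂ closed ideals of A. Then J(I₁) ∩ J(I₂) ⊂ J(I₁ ∩ I₂), where J(I) = {a ∈ A : [φ_X(a)]_I ∈ K(X_I) and a·X⁻¹(I) ⊂ I}. -/

import Mathlib

noncomputable section

/-- A (right) Hilbert C*-module over a C*-algebra `A`. -/
class HilbertModule (A : Type*) [CStarAlgebra A] (X : Type*)
    [NormedAddCommGroup X] [NormedSpace ℂ X] : Type _ where
  rsmul : X → A → X
  inner : X → X → A
  rsmul_add_left : ∀ (x y : X) (a : A), rsmul (x + y) a = rsmul x a + rsmul y a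
  rsmul_add_right : ∀ (x : X) (a b : A), rsmul x (a + b) = rsmul x a + rsmul x b
  rsmul_rsmul : ∀ (x : X) (a b : A), rsmul (rsmul x a) b = rsmul x (a * b)
  rsmul_csmul_left : ∀ (c : ℂ) (x : X) (a : A), rsmul (c • x) a = c • rsmul x a
  rsmul_csmul_right : ∀ (c : ℂ) (x : X) (a : A), rsmul x (c • a) = c • rsmul x a
  inner_add_left : ∀ (x y z : X), inner (x + y) z = inner x z + inner y z
  inner_add_right : ∀ (x y z : X), inner x (y + z) = inner x y + inner x z
  inner_csmul_right : ∀ (c : ℂ) (x y : X), inner x (c • y) = c • inner x y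
  star_inner : ∀ (x y : X), star (inner x y) = inner y x
  inner_rsmul_right : ∀ (x y : X) (a : A), inner x (rsmul y a) = inner x y * a
  inner_self_isPositive : ∀ x : X, ∃ b : A, inner x x = star b * b
  norm_sq_inner : ∀ x : X, ‖x‖ ^ 2 = ‖inner x x‖
  norm_inner_le : ∀ x y : X, ‖inner x y‖ ≤ ‖x‖ * ‖y‖
  norm_rsmul_le : ∀ (x : X) (a : A), ‖rsmul x a‖ ≤ ‖x‖ * ‖a‖

namespace HilbertModule

variable {A : Type*} [CStarAlgebra A] {X : Type*}
  [NormedAddCommGroup X] [NormedSpace ℂ X] [HilbertModule A X]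

/-- The closed submodule `X·S` generated by products `ξ·a`, `a ∈ S`. -/
def idealSub (X : Type*) {A : Type*} [CStarAlgebra A] [NormedAddCommGroup X]
    [NormedSpace ℂ X] [HilbertModule A X] (S : Set A) : Set X :=
  closure (Submodule.span ℂ {x : X | ∃ (ξ : X) (a : A), a ∈ S ∧ x = rsmul ξ a} : Set X)

/-- The rank-one ("theta") operator `ζ ↦ ξ⟨η,ζ⟩`. -/
def rankOne (A : Type*) {X : Type*} [CStarAlgebra A] [NormedAddCommGroup X]
    [NormedSpace ℂ X] [HilbertModule A X] (ξ η : X) : X →L[ℂ] X :=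
  LinearMap.mkContinuous
    { toFun := fun ζ => rsmul ξ (inner (A := A) η ζ)
      map_add' := fun x y => by
        show rsmul ξ (inner (A := A) η (x + y)) = _
        rw [inner_add_right, rsmul_add_right]
      map_smul' := fun c x => by
        show rsmul ξ (inner (A := A) η (c • x)) = _
        simp only [RingHom.id_apply]
        rw [inner_csmul_right, rsmul_csmul_right] }
    (‖ξ‖ * ‖η‖)
    (fun ζ => by
      calc ‖rsmul ξ (inner (A := A) η ζ)‖ ≤ ‖ξ‖ * ‖inner (A := A) η ζ‖ :=
            norm_rsmul_le _ _
        _ ≤ ‖ξ‖ * (‖η‖ * ‖ζ‖) :=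
            mul_le_mul_of_nonneg_left (norm_inner_le _ _) (norm_nonneg _)
        _ = ‖ξ‖ * ‖η‖ * ‖ζ‖ := (mul_assoc _ _ _).symm)

/-- The set of "compact" operators `K(X)`: the closed linear span of rank-one operators. -/
def compacts (A X : Type*) [CStarAlgebra A] [NormedAddCommGroup X]
    [NormedSpace ℂ X] [HilbertModule A X] : Set (X →L[ℂ] X) :=
  closure (Submodule.span ℂ {T : X →L[ℂ] X | ∃ ξ η : X, T = rankOne A ξ η} : Set (X →L[ℂ] X))

/-- `K(X·I)`, viewed inside the operators on `X`: the closed span of rank-one operators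
with both legs in the subset `S`. -/
def compactsOn (A : Type*) {X : Type*} [CStarAlgebra A] [NormedAddCommGroup X]
    [NormedSpace ℂ X] [HilbertModule A X] (S : Set X) : Set (X →L[ℂ] X) :=
  closure (Submodule.span ℂ
    {T : X →L[ℂ] X | ∃ ξ ∈ S, ∃ η ∈ S, T = rankOne A ξ η} : Set (X →L[ℂ] X))

/-- An operator is adjointable if it has an adjoint with respect to the `A`-valued
inner product. -/
def IsAdjointable (A : Type*) {X : Type*} [CStarAlgebra A] [NormedAddCommGroup X]
    [NormedSpace ℂ X] [HilbertModule A X] (S : X →L[ℂ] X) : Prop :=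
  ∃ T : X →L[ℂ] X, ∀ x y : X, inner (A := A) (S x) y = inner (A := A) x (T y)

end HilbertModule

/-- A C*-correspondence over `A`: a Hilbert `A`-module with a left action of `A`
by adjointable operators. -/
class Correspondence (A : Type*) [CStarAlgebra A] (X : Type*)
    [NormedAddCommGroup X] [NormedSpace ℂ X] extends HilbertModule A X where
  lsmul : A → X → X
  lsmul_add_left : ∀ (a b : A) (x : X), lsmul (a + b) x = lsmul a x + lsmul b x
  lsmul_add_right : ∀ (a : A) (x y : X), lsmul a (x + y) = lsmul a x + lsmul a y
  lsmul_mul : ∀ (a b : A) (x : X), lsmul (a * b) x = lsmul a (lsmul b x)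
  lsmul_csmul_left : ∀ (c : ℂ) (a : A) (x : X), lsmul (c • a) x = c • lsmul a x
  lsmul_csmul_right : ∀ (c : ℂ) (a : A) (x : X), lsmul a (c • x) = c • lsmul a x
  inner_lsmul_left : ∀ (a : A) (x y : X), inner (lsmul a x) y = inner x (lsmul (star a) y)
  lsmul_rsmul : ∀ (a : A) (x : X) (b : A), lsmul a (rsmul x b) = rsmul (lsmul a x) b
  norm_lsmul_le : ∀ (a : A) (x : X), ‖lsmul a x‖ ≤ ‖a‖ * ‖x‖

namespace Correspondence

open HilbertModule

variable {A : Type*} [CStarAlgebra A] {X : Type*}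
  [NormedAddCommGroup X] [NormedSpace ℂ X] [Correspondence A X]

/-- The left action `φ_X(a)` as a continuous linear operator on `X`. -/
def lact (A : Type*) {X : Type*} [CStarAlgebra A] [NormedAddCommGroup X]
    [NormedSpace ℂ X] [Correspondence A X] (a : A) : X →L[ℂ] X :=
  LinearMap.mkContinuous
    { toFun := lsmul a
      map_add' := lsmul_add_right a
      map_smul' := fun c x => by
        show lsmul a (c • x) = _
        simp only [RingHom.id_apply]; rw [lsmul_csmul_right] }
    ‖a‖ (norm_lsmul_le a)

/-- The ideal `X(S)`: closed span of `{⟨η, φ_X(a)ξ⟩ : a ∈ S}`. -/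
def corrApply (X : Type*) {A : Type*} [CStarAlgebra A] [NormedAddCommGroup X]
    [NormedSpace ℂ X] [Correspondence A X] (S : Set A) : Set A :=
  closure (Submodule.span ℂ
    {b : A | ∃ a ∈ S, ∃ ξ η : X, b = inner (A := A) η (lsmul a ξ)} : Set A)

/-- The ideal `X⁻¹(S) = {a : ⟨η, φ_X(a)ξ⟩ ∈ S for all ξ, η}`. -/
def corrInv (X : Type*) {A : Type*} [CStarAlgebra A] [NormedAddCommGroup X]
    [NormedSpace ℂ X] [Correspondence A X] (S : Set A) : Set A :=
  {a : A | ∀ ξ η : X, inner (A := A) η (lsmul a ξ) ∈ S}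

/-- The kernel of the left action `φ_X`. -/
def kerLact (X : Type*) {A : Type*} [CStarAlgebra A] [NormedAddCommGroup X]
    [NormedSpace ℂ X] [Correspondence A X] : Set A :=
  {a : A | ∀ ξ : X, lsmul a ξ = 0}

/-- Katsura's ideal `J_X = φ_X⁻¹(K(X)) ∩ (ker φ_X)^⊥`. -/
def JX (X : Type*) {A : Type*} [CStarAlgebra A] [NormedAddCommGroup X]
    [NormedSpace ℂ X] [Correspondence A X] : Set A :=
  {a : A | lact A (X := X) a ∈ compacts A X ∧ ∀ b ∈ kerLact X, a * b = 0}

end Correspondence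

open HilbertModule Correspondence

/-- Data presenting a Hilbert `B`-module `Y` as the quotient `X_I = X/XI` of a Hilbert
`A`-module `X` by a closed two-sided ideal `I` of `A` (with `B` playing the role of `A/I`). -/
structure QuotientData (A B : Type*) [CStarAlgebra A] [CStarAlgebra B]
    (I : TwoSidedIdeal A)
    (X Y : Type*) [NormedAddCommGroup X] [NormedSpace ℂ X] [HilbertModule A X]
    [NormedAddCommGroup Y] [NormedSpace ℂ Y] [HilbertModule B Y] : Type _ where
  π : A →⋆ₐ[ℂ] B
  π_surjective : Function.Surjective π
  π_ker : ∀ a : A, π a = 0 ↔ a ∈ I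
  q : X →ₗ[ℂ] Y
  q_surjective : Function.Surjective q
  q_ker : ∀ ξ : X, q ξ = 0 ↔ ξ ∈ idealSub X (I : Set A)
  q_inner : ∀ ξ ζ : X, inner (A := B) (q ξ) (q ζ) = π (inner (A := A) ξ ζ)
  q_rsmul : ∀ (ξ : X) (a : A), q (rsmul ξ a) = rsmul (q ξ) (π a)


/-- Quotient data compatible with the left actions (presenting `X_I` as a
C*-correspondence over `A/I`). -/
structure CorrQuotientData (A B : Type*) [CStarAlgebra A] [CStarAlgebra B]
    (I : TwoSidedIdeal A)
    (X Y : Type*) [NormedAddCommGroup X] [NormedSpace ℂ X] [Correspondence A X]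
    [NormedAddCommGroup Y] [NormedSpace ℂ Y] [Correspondence B Y]
    extends QuotientData A B I X Y where
  q_lsmul : ∀ (a : A) (ξ : X), q (lsmul a ξ) = lsmul (π a) (q ξ)

/-- Katsura's ideal `J(I) = {a : [φ_X(a)]_I ∈ K(X_I), a·X⁻¹(I) ⊂ I}`, expressed via
quotient data presenting `X_I`. -/
def JofI {A B : Type*} [CStarAlgebra A] [CStarAlgebra B] {I : TwoSidedIdeal A}
    {X Y : Type*} [NormedAddCommGroup X] [NormedSpace ℂ X] [Correspondence A X]
    [NormedAddCommGroup Y] [NormedSpace ℂ Y] [HilbertModule B Y]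
    (D : QuotientData A B I X Y) : Set A :=
  {a : A | (∃ T ∈ compacts B Y, ∀ ξ : X, T (D.q ξ) = D.q (lsmul a ξ)) ∧
    ∀ b ∈ corrInv X (I : Set A), a * b ∈ I}

/-- A Hilbert `A`-bimodule: a C*-correspondence together with a left inner product
satisfying `φ_X(⟪ξ,η⟫) = θ_{ξ,η}`. -/
class HilbertBimodule (A : Type*) [CStarAlgebra A] (X : Type*)
    [NormedAddCommGroup X] [NormedSpace ℂ X] extends Correspondence A X where
  linner : X → X → A
  lsmul_linner : ∀ ξ η ζ : X, lsmul (linner ξ η) ζ = rsmul ξ (inner η ζ)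

/-- The closed subspace `φ_X(S)X`: closed span of `{φ_X(a)ξ : a ∈ S}`. -/
def lsmulSet (X : Type*) {A : Type*} [CStarAlgebra A] [NormedAddCommGroup X]
    [NormedSpace ℂ X] [Correspondence A X] (S : Set A) : Set X :=
  closure (Submodule.span ℂ
    {x : X | ∃ a ∈ S, ∃ ξ : X, x = Correspondence.lsmul a ξ} : Set X)

/-! ### An abstract C*-algebraic gluing lemma -/

/-- `a` is approximated, in the seminorm `‖ρ ·‖`, by elements of `F`. -/
def Apx {M N : Type*} [CStarAlgebra M] [CStarAlgebra N] (F : Set M) (ρ : M →⋆ₐ[ℂ] N)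
    (a : M) : Prop :=
  ∀ ε : ℝ, 0 < ε → ∃ f ∈ F, ‖ρ (a - f)‖ ≤ ε

lemma norm_mul_cfc_sq {M : Type*} [CStarAlgebra M] (k : M) (g : ℝ → ℝ) (hg : Continuous g)
    (c : ℝ) (hc : 0 ≤ c) (h : ∀ t : ℝ, ‖g t * t * g t‖ ≤ c ^ 2) :
    ‖k * cfc g (star k * k)‖ ≤ c := by
  have hs : IsSelfAdjoint (star k * k) := IsSelfAdjoint.star_mul_self k
  have e : star (k * cfc g (star k * k)) * (k * cfc g (star k * k))
      = cfc (fun t => g t * t * g t) (star k * k) := by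
    rw [cfc_mul (fun t => g t * t) g _ (by fun_prop) (by fun_prop),
      cfc_mul g (fun t => t) _ (by fun_prop) (by fun_prop), cfc_id' ℝ (star k * k)]
    rw [star_mul]
    have : star (cfc g (star k * k)) = cfc g (star k * k) :=
      (IsSelfAdjoint.cfc (f := g) (a := star k * k)).star_eq
    rw [this]
    simp only [mul_assoc]
  have h2 : ‖k * cfc g (star k * k)‖ ^ 2 ≤ c ^ 2 := by
    rw [sq, ← CStarRing.norm_star_mul_self, e]
    exact norm_cfc_le (by positivity) (fun t _ => h t)
  exact le_of_sq_le_sq h2 hc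

lemma exists_bounded_lift {M N : Type*} [CStarAlgebra M] [CStarAlgebra N] (ρ : M →⋆ₐ[ℂ] N)
    (k : M) (r : ℝ) (hr : 0 < r) (hk : ‖ρ k‖ ≤ r) :
    ∃ m : M, ρ (k * m) = ρ k ∧ ‖k * m‖ ≤ r := by
  have hr2 : 0 < r ^ 2 := by positivity
  set g : ℝ → ℝ := fun t => r ^ 2 / max |t| (r ^ 2) with hgdef
  have hpos : ∀ t : ℝ, 0 < max |t| (r ^ 2) := fun t => lt_max_of_lt_right hr2
  have hg : Continuous g := by
    refine continuous_const.div (by fun_prop) (fun t => (hpos t).ne')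
  refine ⟨cfc g (star k * k), ?_, ?_⟩
  · have hs : IsSelfAdjoint (star k * k) := IsSelfAdjoint.star_mul_self k
    have hs' : IsSelfAdjoint (ρ (star k * k)) := hs.map ρ
    have hcont : Continuous ρ :=
      AddMonoidHomClass.continuous_of_bound ρ 1 (fun x => by
        rw [one_mul]; exact NonUnitalStarAlgHom.norm_apply_le ρ x)
    have h1 : ρ (cfc g (star k * k)) = cfc g (ρ (star k * k)) :=
      StarAlgHomClass.map_cfc (S := ℂ) ρ g (star k * k) (by fun_prop) hcont hs hs'
    have h2 : cfc g (ρ (star k * k)) = 1 := by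
      rw [← cfc_const_one ℝ (ρ (star k * k))]
      refine cfc_congr (fun t ht => ?_)
      have hn : ‖t‖ ≤ ‖ρ (star k * k)‖ := by
        rcases subsingleton_or_nontrivial N with hN | hN
        · exact absurd ht (by rw [spectrum.of_subsingleton]; simp)
        · exact spectrum.norm_le_norm_of_mem ht
      have hn2 : |t| ≤ r ^ 2 := by
        refine hn.trans ?_
        rw [map_mul, map_star, CStarRing.norm_star_mul_self, sq]
        exact mul_self_le_mul_self (norm_nonneg _) hk
      simp only [hgdef, max_eq_right hn2]
      exact div_self hr2.ne'
    rw [map_mul, h1, h2, mul_one]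
  · refine norm_mul_cfc_sq k g hg r hr.le (fun t => ?_)
    have h1 : |t| ≤ max |t| (r ^ 2) := le_max_left _ _
    have h2 : r ^ 2 ≤ max |t| (r ^ 2) := le_max_right _ _
    have h3 := hpos t
    simp only [hgdef]
    generalize max |t| (r ^ 2) = m at *
    rw [norm_mul, norm_mul, Real.norm_eq_abs, Real.norm_eq_abs,
      abs_of_nonneg (div_nonneg hr2.le h3.le)]
    have h4 : r ^ 2 / m ≤ 1 := (div_le_one h3).2 h2
    have h5 : 0 ≤ r ^ 2 / m := div_nonneg hr2.le h3.le
    calc r ^ 2 / m * |t| * (r ^ 2 / m) ≤ r ^ 2 / m * m * 1 := by gcongr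
      _ = r ^ 2 := by field_simp

lemma exists_approx_factor {M : Type*} [CStarAlgebra M] (a : M) (δ : ℝ) (hδ : 0 < δ) :
    ∃ b c : M, ‖a - a * (c * a * b)‖ ≤ δ := by
  have hs : IsSelfAdjoint (star a * a) := IsSelfAdjoint.star_mul_self a
  set h := star a * a with hh
  set η := δ ^ 2 with hη
  have hη0 : 0 < η := by positivity
  have hpos : ∀ t : ℝ, 0 < t ^ 2 + η ^ 2 := fun t => by positivity
  set g : ℝ → ℝ := fun t => t / (t ^ 2 + η ^ 2) with hgdef
  set g' : ℝ → ℝ := fun t => η ^ 2 / (t ^ 2 + η ^ 2) with hgdef'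
  have hg : Continuous g := by
    refine Continuous.div (by fun_prop) (by fun_prop) (fun t => (hpos t).ne')
  have hg' : Continuous g' := by
    refine Continuous.div (by fun_prop) (by fun_prop) (fun t => (hpos t).ne')
  refine ⟨cfc g h, star a, ?_⟩
  have e : cfc g' h + h * cfc g h = 1 := by
    conv_lhs => rw [← cfc_id' ℝ h]
    rw [cfc_id' ℝ h]
    have : h * cfc g h = cfc (fun t => t * g t) h := by
      rw [cfc_mul (fun t => t) g h (by fun_prop) (by fun_prop), cfc_id' ℝ h]
    rw [this, ← cfc_add h g' (fun t => t * g t) (by fun_prop) (by fun_prop),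
      ← cfc_const_one ℝ h]
    refine cfc_congr (fun t _ => ?_)
    simp only [hgdef, hgdef']
    have := (hpos t).ne'
    field_simp
    ring
  have e2 : a - a * (star a * a * cfc g h) = a * cfc g' h := by
    rw [← hh, eq_sub_of_add_eq e, mul_sub, mul_one]
  rw [e2]
  refine norm_mul_cfc_sq a g' hg' δ hδ.le (fun t => ?_)
  rw [← hη]
  simp only [hgdef']
  rw [norm_mul, norm_mul, Real.norm_eq_abs, Real.norm_eq_abs,
      abs_of_nonneg (div_nonneg (by positivity) (hpos t).le)]
  have h0 := hpos t
  have : η ^ 2 / (t ^ 2 + η ^ 2) * |t| * (η ^ 2 / (t ^ 2 + η ^ 2))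
      = (η ^ 2 * |t| * η ^ 2) / (t ^ 2 + η ^ 2) ^ 2 := by
    field_simp
  rw [this, div_le_iff₀ (by positivity)]
  have h1 : 2 * |t| * η ≤ t ^ 2 + η ^ 2 := by
    have := sq_nonneg (|t| - η)
    rw [← sq_abs t]; nlinarith
  have h2 : η ^ 2 ≤ t ^ 2 + η ^ 2 := by nlinarith [sq_nonneg t]
  have h3 : 0 ≤ |t| := abs_nonneg t
  have h4 : (|t| * η) * η ^ 2 ≤ (t ^ 2 + η ^ 2) * (t ^ 2 + η ^ 2) := by
    have : |t| * η ≤ t ^ 2 + η ^ 2 := by nlinarith [mul_nonneg h3 hη0.le]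
    gcongr
  calc η ^ 2 * |t| * η ^ 2 = η * ((|t| * η) * η ^ 2) := by ring
    _ ≤ η * ((t ^ 2 + η ^ 2) * (t ^ 2 + η ^ 2)) := by gcongr
    _ = _ := by ring

lemma Apx.bounded {M N : Type*} [CStarAlgebra M] [CStarAlgebra N] {F : Set M}
    (hFr : ∀ f ∈ F, ∀ m, f * m ∈ F) {ρ : M →⋆ₐ[ℂ] N} {a : M} (h : Apx F ρ a)
    (ε : ℝ) (hε : 0 < ε) (hε1 : ε ≤ 1) :
    ∃ f ∈ F, ‖ρ (a - f)‖ ≤ ε ∧ ‖f‖ ≤ ‖a‖ + 1 := by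
  obtain ⟨f, hf, hfε⟩ := h ε hε
  have hb : ‖ρ f‖ ≤ ‖a‖ + 1 := by
    have h1 : ρ f = ρ a - ρ (a - f) := by simp
    rw [h1]
    refine (norm_sub_le _ _).trans ?_
    have := NonUnitalStarAlgHom.norm_apply_le ρ a
    linarith
  obtain ⟨m, hm, hm'⟩ := exists_bounded_lift ρ f (‖a‖ + 1) (by positivity) hb
  refine ⟨f * m, hFr f hf m, ?_, hm'⟩
  rw [map_sub, hm, ← map_sub]
  exact hfε

lemma apx_mul {M N₁ N₂ N : Type*} [CStarAlgebra M] [CStarAlgebra N₁] [CStarAlgebra N₂]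
    [CStarAlgebra N] {F : Set M}
    (hFadd : ∀ f ∈ F, ∀ g ∈ F, f + g ∈ F)
    (hFl : ∀ f ∈ F, ∀ m, m * f ∈ F) (hFr : ∀ f ∈ F, ∀ m, f * m ∈ F)
    (ρ₁ : M →⋆ₐ[ℂ] N₁) (ρ₂ : M →⋆ₐ[ℂ] N₂) (ρ : M →⋆ₐ[ℂ] N)
    (hρ : ∀ w c, ‖ρ₁ w‖ ≤ c → ‖ρ₂ w‖ ≤ c → ‖ρ w‖ ≤ c)
    {a b : M} (ha : Apx F ρ₁ a) (hb : Apx F ρ₂ b) : Apx F ρ (a * b) := by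
  intro ε hε
  set R := 2 * ‖a‖ + 2 * ‖b‖ + 1 with hR
  have hR0 : 0 < R := by positivity
  set ε' := min 1 (ε / R) with hε'
  have h0 : 0 < ε' := by positivity
  have h1 : ε' ≤ 1 := min_le_left _ _
  have h2 : ε' * R ≤ ε := by
    have : ε' ≤ ε / R := min_le_right _ _
    rwa [le_div_iff₀ hR0] at this
  obtain ⟨f, hf, hfε, hfn⟩ := ha.bounded hFr ε' h0 h1
  obtain ⟨g, hg, hgε, hgn⟩ := hb.bounded hFr ε' h0 h1
  refine ⟨f * b + (a - f) * g, hFadd _ (hFr f hf b) _ (hFl g hg _), ?_⟩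
  have e : a * b - (f * b + (a - f) * g) = (a - f) * (b - g) := by noncomm_ring
  rw [e]
  have na : ‖a - f‖ ≤ R := (norm_sub_le _ _).trans (by linarith [norm_nonneg a, norm_nonneg b])
  have nb : ‖b - g‖ ≤ R := (norm_sub_le _ _).trans (by linarith [norm_nonneg a, norm_nonneg b])
  refine hρ _ _ ?_ ?_
  · rw [map_mul]
    refine (norm_mul_le _ _).trans (le_trans ?_ h2)
    have := (NonUnitalStarAlgHom.norm_apply_le ρ₁ (b - g)).trans nb
    gcongr
  · rw [map_mul]
    refine (norm_mul_le _ _).trans (le_trans ?_ h2)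
    have := (NonUnitalStarAlgHom.norm_apply_le ρ₂ (a - f)).trans na
    rw [mul_comm]
    gcongr

lemma apx_glue {M N₁ N₂ N : Type*} [CStarAlgebra M] [CStarAlgebra N₁] [CStarAlgebra N₂]
    [CStarAlgebra N] {F : Set M}
    (hFadd : ∀ f ∈ F, ∀ g ∈ F, f + g ∈ F)
    (hFl : ∀ f ∈ F, ∀ m, m * f ∈ F) (hFr : ∀ f ∈ F, ∀ m, f * m ∈ F)
    (ρ₁ : M →⋆ₐ[ℂ] N₁) (ρ₂ : M →⋆ₐ[ℂ] N₂) (ρ : M →⋆ₐ[ℂ] N)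
    (hρ : ∀ w c, ‖ρ₁ w‖ ≤ c → ‖ρ₂ w‖ ≤ c → ‖ρ w‖ ≤ c)
    {a : M} (ha : Apx F ρ₁ a) (hb : Apx F ρ₂ a) : Apx F ρ a := by
  intro ε hε
  obtain ⟨b, c, hbc⟩ := exists_approx_factor a (ε / 2) (by positivity)
  have h2 : Apx F ρ₂ (c * a * b) := by
    intro δ hδ
    have hR0 : 0 < ‖c‖ * ‖b‖ + 1 := by positivity
    obtain ⟨f, hf, hfε⟩ := hb (δ / (‖c‖ * ‖b‖ + 1)) (by positivity)
    refine ⟨c * f * b, hFr _ (hFl f hf c) b, ?_⟩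
    have e : c * a * b - c * f * b = c * (a - f) * b := by noncomm_ring
    rw [e, map_mul, map_mul]
    rw [le_div_iff₀ hR0] at hfε
    calc ‖ρ₂ c * ρ₂ (a - f) * ρ₂ b‖ ≤ ‖ρ₂ c‖ * ‖ρ₂ (a - f)‖ * ‖ρ₂ b‖ := norm_mul₃_le
      _ ≤ ‖c‖ * ‖ρ₂ (a - f)‖ * ‖b‖ := by
        have := NonUnitalStarAlgHom.norm_apply_le ρ₂ c
        have := NonUnitalStarAlgHom.norm_apply_le ρ₂ b
        gcongr
      _ ≤ δ := by nlinarith [norm_nonneg (ρ₂ (a - f))]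
  obtain ⟨f, hf, hfε⟩ := apx_mul hFadd hFl hFr ρ₁ ρ₂ ρ hρ ha h2 (ε / 2) (by positivity)
  refine ⟨f, hf, ?_⟩
  have e : a - f = (a - a * (c * a * b)) + (a * (c * a * b) - f) := by abel
  rw [e, map_add]
  refine (norm_add_le _ _).trans ?_
  have := NonUnitalStarAlgHom.norm_apply_le ρ (a - a * (c * a * b))
  linarith

/-! ### The C*-algebra of adjointable operators -/

section AdjAlgebra

variable (A : Type*) [CStarAlgebra A] (X : Type*)
  [NormedAddCommGroup X] [NormedSpace ℂ X] [HilbertModule A X]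

variable {A X} in
lemma hm_inner_zero_right (x : X) : HilbertModule.inner (A := A) x (0 : X) = 0 := by
  have := HilbertModule.inner_csmul_right (A := A) 0 x (0 : X)
  simpa using this

variable {A X} in
lemma hm_inner_zero_left (x : X) : HilbertModule.inner (A := A) (0 : X) x = 0 := by
  rw [← HilbertModule.star_inner, hm_inner_zero_right, star_zero]

variable {A X} in
lemma hm_inner_csmul_left (c : ℂ) (x y : X) :
    HilbertModule.inner (A := A) (c • x) y = star c • HilbertModule.inner (A := A) x y := by
  rw [← HilbertModule.star_inner, HilbertModule.inner_csmul_right, star_smul,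
    HilbertModule.star_inner]

variable {A X} in
lemma hm_inner_neg_left (x y : X) :
    HilbertModule.inner (A := A) (-x) y = - HilbertModule.inner (A := A) x y := by
  have := hm_inner_csmul_left (A := A) (-1) x y
  simpa using this

variable {A X} in
lemma hm_inner_neg_right (x y : X) :
    HilbertModule.inner (A := A) x (-y) = - HilbertModule.inner (A := A) x y := by
  have := HilbertModule.inner_csmul_right (A := A) (-1) x y
  simpa using this

variable {A X} in
lemma hm_eq_zero (x : X) (h : HilbertModule.inner (A := A) x x = 0) : x = 0 := by
  have := HilbertModule.norm_sq_inner (A := A) x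
  rw [h, norm_zero] at this
  simpa using this

variable {A X} in
lemma hm_ext {x y : X}
    (h : ∀ z, HilbertModule.inner (A := A) z x = HilbertModule.inner (A := A) z y) : x = y := by
  rw [← sub_eq_zero]
  apply hm_eq_zero (A := A)
  have := h (x - y)
  have e : ∀ w : X, HilbertModule.inner (A := A) w (x - y)
      = HilbertModule.inner (A := A) w x - HilbertModule.inner (A := A) w y := fun w => by
    rw [sub_eq_add_neg, HilbertModule.inner_add_right, hm_inner_neg_right, ← sub_eq_add_neg]
  rw [e, this, sub_self]

variable {A X} in
lemma hm_inner_rsmul_left (x y : X) (a : A) :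
    HilbertModule.inner (HilbertModule.rsmul x a) y
      = star a * HilbertModule.inner (A := A) x y := by
  rw [← HilbertModule.star_inner, HilbertModule.inner_rsmul_right, star_mul,
    HilbertModule.star_inner]

variable {A X} in
lemma hm_continuous_right (x : X) : Continuous (fun y : X => HilbertModule.inner (A := A) x y) := by
  let f : X →+ A := 
    { toFun := fun y => HilbertModule.inner (A := A) x y
      map_zero' := hm_inner_zero_right x
      map_add' := HilbertModule.inner_add_right x }
  exact AddMonoidHomClass.continuous_of_bound f ‖x‖ (fun y => HilbertModule.norm_inner_le x y)

variable {A X} in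
lemma hm_continuous_left (y : X) : Continuous (fun x : X => HilbertModule.inner (A := A) x y) := by
  have : (fun x : X => HilbertModule.inner (A := A) x y)
      = fun x => star (HilbertModule.inner (A := A) y x) := by
    funext x; rw [HilbertModule.star_inner]
  rw [this]
  exact (hm_continuous_right y).star

/-- Pairs `(T, T*)`. -/
def adjSubring : Subring ((X →L[ℂ] X) × (X →L[ℂ] X)ᵐᵒᵖ) where
  carrier := {p | ∀ x y : X, HilbertModule.inner (A := A) (p.1 x) y
    = HilbertModule.inner (A := A) x (p.2.unop y)}
  mul_mem' := by
    intro p q hp hq x y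
    simp only [Set.mem_ofPred_eq] at hp hq ⊢
    simp only [Prod.fst_mul, Prod.snd_mul, MulOpposite.unop_mul, mul_apply_eq_comp]
    rw [hp, hq]
  one_mem' := by intro x y; simp
  add_mem' := by
    intro p q hp hq x y
    simp only [Set.mem_ofPred_eq] at hp hq ⊢
    simp only [Prod.fst_add, Prod.snd_add, MulOpposite.unop_add, add_apply]
    rw [HilbertModule.inner_add_left, HilbertModule.inner_add_right, hp, hq]
  zero_mem' := by
    intro x y
    simp [hm_inner_zero_left, hm_inner_zero_right]
  neg_mem' := by
    intro p hp x y
    simp only [Set.mem_ofPred_eq] at hp ⊢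
    simp only [Prod.fst_neg, Prod.snd_neg, MulOpposite.unop_neg, neg_apply]
    rw [hm_inner_neg_left, hm_inner_neg_right, hp]

lemma adjSubring_isClosed : IsClosed (adjSubring A X : Set ((X →L[ℂ] X) × (X →L[ℂ] X)ᵐᵒᵖ)) := by
  have : (adjSubring A X : Set ((X →L[ℂ] X) × (X →L[ℂ] X)ᵐᵒᵖ))
      = ⋂ x : X, ⋂ y : X, {p | HilbertModule.inner (A := A) (p.1 x) y
    = HilbertModule.inner (A := A) x (p.2.unop y)} := by
    ext p; simp only [Set.mem_iInter]; rfl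
  rw [this]
  refine isClosed_iInter fun x => isClosed_iInter fun y => isClosed_eq ?_ ?_
  · exact (hm_continuous_left y).comp (by fun_prop)
  · refine (hm_continuous_right x).comp ?_
    have h1 : Continuous fun p : (X →L[ℂ] X) × (X →L[ℂ] X)ᵐᵒᵖ => p.2.unop :=
      MulOpposite.continuous_unop.comp continuous_snd
    exact h1.clm_apply continuous_const

/-- The algebra of adjointable operators. -/
def Adj : Type _ := ↥(adjSubring A X)

instance : NormedRing (Adj A X) := inferInstanceAs (NormedRing ↥(adjSubring A X))

variable {A X}

/-- underlying operator -/
def Adj.op (T : Adj A X) : X →L[ℂ] X := T.1.1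

/-- adjoint operator -/
def Adj.adj (T : Adj A X) : X →L[ℂ] X := T.1.2.unop

/-- constructor -/
def Adj.mk (T S : X →L[ℂ] X) (h : ∀ x y : X, HilbertModule.inner (A := A) (T x) y
    = HilbertModule.inner (A := A) x (S y)) : Adj A X := ⟨(T, MulOpposite.op S), h⟩

@[simp] lemma Adj.op_mk (T S : X →L[ℂ] X) (h) : (Adj.mk (A := A) T S h).op = T := rfl
@[simp] lemma Adj.adj_mk (T S : X →L[ℂ] X) (h) : (Adj.mk (A := A) T S h).adj = S := rfl

lemma Adj.inner_op (T : Adj A X) (x y : X) : HilbertModule.inner (A := A) (T.op x) y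
    = HilbertModule.inner (A := A) x (T.adj y) := T.2 x y

lemma Adj.inner_adj (T : Adj A X) (x y : X) : HilbertModule.inner (A := A) (T.adj x) y
    = HilbertModule.inner (A := A) x (T.op y) := by
  rw [← HilbertModule.star_inner, ← T.inner_op, HilbertModule.star_inner]

lemma Adj.ext' {S T : Adj A X} (h : S.op = T.op) (h' : S.adj = T.adj) : S = T :=
  Subtype.ext (Prod.ext h (MulOpposite.unop_injective h'))

lemma Adj.ext {S T : Adj A X} (h : ∀ x, S.op x = T.op x) : S = T := by
  refine Adj.ext' (ContinuousLinearMap.ext h) (ContinuousLinearMap.ext fun y => ?_)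
  refine hm_ext (A := A) fun z => ?_
  rw [← S.inner_op, ← T.inner_op, h]

@[simp] lemma Adj.op_add (S T : Adj A X) : (S + T).op = S.op + T.op := rfl
@[simp] lemma Adj.adj_add (S T : Adj A X) : (S + T).adj = S.adj + T.adj := rfl
@[simp] lemma Adj.op_sub (S T : Adj A X) : (S - T).op = S.op - T.op := rfl
@[simp] lemma Adj.op_mul (S T : Adj A X) : (S * T).op = S.op * T.op := rfl
@[simp] lemma Adj.adj_mul (S T : Adj A X) : (S * T).adj = T.adj * S.adj := rfl
@[simp] lemma Adj.op_one : (1 : Adj A X).op = 1 := rfl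
@[simp] lemma Adj.adj_one : (1 : Adj A X).adj = 1 := rfl
@[simp] lemma Adj.op_zero : (0 : Adj A X).op = 0 := rfl
@[simp] lemma Adj.adj_zero : (0 : Adj A X).adj = 0 := rfl

lemma Adj.norm_def (T : Adj A X) : ‖T‖ = max ‖T.op‖ ‖T.adj‖ := rfl

lemma Adj.norm_op_sq (T : Adj A X) : ‖T.op‖ * ‖T.op‖ ≤ ‖T.adj * T.op‖ := by
  have h : ‖T.op‖ ≤ Real.sqrt ‖T.adj * T.op‖ := by
    refine ContinuousLinearMap.opNorm_le_bound _ (Real.sqrt_nonneg _) fun x => ?_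
    refine le_of_sq_le_sq ?_ (by positivity)
    rw [HilbertModule.norm_sq_inner (A := A), T.inner_op, mul_pow, Real.sq_sqrt (norm_nonneg _)]
    refine (HilbertModule.norm_inner_le _ _).trans ?_
    have : ‖T.adj (T.op x)‖ ≤ ‖T.adj * T.op‖ * ‖x‖ := (T.adj * T.op).le_opNorm x
    nlinarith [norm_nonneg x]
  calc ‖T.op‖ * ‖T.op‖ ≤ Real.sqrt ‖T.adj * T.op‖ * Real.sqrt ‖T.adj * T.op‖ := by gcongr
    _ = _ := Real.mul_self_sqrt (norm_nonneg _)

lemma Adj.norm_op_le (T : Adj A X) : ‖T.op‖ ≤ ‖T.adj‖ := by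
  by_contra! h
  have h1 := T.norm_op_sq
  have h2 : ‖T.adj * T.op‖ ≤ ‖T.adj‖ * ‖T.op‖ := norm_mul_le _ _
  nlinarith [norm_nonneg T.op, norm_nonneg T.adj]

instance : Star (Adj A X) := ⟨fun T => Adj.mk T.adj T.op T.inner_adj⟩

@[simp] lemma Adj.op_star (T : Adj A X) : (star T).op = T.adj := rfl
@[simp] lemma Adj.adj_star (T : Adj A X) : (star T).adj = T.op := rfl

lemma Adj.norm_eq_op (T : Adj A X) : ‖T‖ = ‖T.op‖ := by
  rw [Adj.norm_def]
  exact max_eq_left ((star T).norm_op_le)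

instance : StarRing (Adj A X) where
  star_involutive _ := rfl
  star_mul _ _ := rfl
  star_add _ _ := rfl

instance : CStarRing (Adj A X) where
  norm_mul_self_le T := by
    rw [Adj.norm_eq_op, Adj.norm_eq_op]
    exact T.norm_op_sq

/-- scalars in the adjointable operators -/
def Adj.scalar : ℂ →+* Adj A X where
  toFun c := Adj.mk (c • 1) (star c • 1) (fun x y => by
    simp only [smul_apply, one_apply_eq_self]
    rw [hm_inner_csmul_left, HilbertModule.inner_csmul_right])
  map_one' := Adj.ext fun x => by simp
  map_mul' c d := Adj.ext fun x => by simp [mul_smul, smul_comm d c]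
  map_zero' := Adj.ext fun x => by simp
  map_add' c d := Adj.ext fun x => by simp [add_smul]

instance : Algebra ℂ (Adj A X) :=
  RingHom.toAlgebra' Adj.scalar (fun c T => Adj.ext fun x => by simp [Adj.scalar])

@[simp] lemma Adj.op_smul (c : ℂ) (T : Adj A X) : (c • T).op = c • T.op := by
  rw [Algebra.smul_def]
  show (Adj.scalar c * T).op = _
  ext x
  simp [Adj.scalar]

@[simp] lemma Adj.op_algebraMap (c : ℂ) : (algebraMap ℂ (Adj A X) c).op = c • 1 := rfl

instance : NormedAlgebra ℂ (Adj A X) where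
  norm_smul_le c T := by
    rw [Adj.norm_eq_op, Adj.norm_eq_op, Adj.op_smul]
    exact norm_smul_le c T.op

lemma Adj.eq_star_of {S T : Adj A X} (h : ∀ x y, HilbertModule.inner (A := A) (T.op x) y
    = HilbertModule.inner (A := A) x (S.op y)) : star T = S := by
  refine Adj.ext fun y => hm_ext (A := A) fun z => ?_
  rw [← h, Adj.op_star, T.inner_op]

instance : StarModule ℂ (Adj A X) where
  star_smul c T := Adj.eq_star_of fun x y => by
    rw [Adj.op_smul, Adj.op_smul, smul_apply, smul_apply,
      hm_inner_csmul_left, HilbertModule.inner_csmul_right, T.inner_op, Adj.op_star]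

instance [CompleteSpace X] : CompleteSpace (Adj A X) :=
  (adjSubring_isClosed A X).completeSpace_coe

instance [CompleteSpace X] : CStarAlgebra (Adj A X) where

end AdjAlgebra

/-! ### Finite rank operators -/

section FiniteRank

variable {A : Type*} [CStarAlgebra A] {X : Type*}
  [NormedAddCommGroup X] [NormedSpace ℂ X] [HilbertModule A X]

/-- Span of the rank one operators. -/
def finRank (A X : Type*) [CStarAlgebra A] [NormedAddCommGroup X]
    [NormedSpace ℂ X] [HilbertModule A X] : Submodule ℂ (X →L[ℂ] X) :=
  Submodule.span ℂ {T : X →L[ℂ] X | ∃ ξ η : X, T = HilbertModule.rankOne A ξ η}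

lemma rankOne_apply' (ξ η ζ : X) : HilbertModule.rankOne A ξ η ζ
    = HilbertModule.rsmul ξ (HilbertModule.inner (A := A) η ζ) := rfl

/-- The adjointable rank one operator. -/
def Adj.theta (ξ η : X) : Adj A X :=
  Adj.mk (HilbertModule.rankOne A ξ η) (HilbertModule.rankOne A η ξ) (fun x y => by
    rw [rankOne_apply', rankOne_apply', hm_inner_rsmul_left, HilbertModule.inner_rsmul_right,
      HilbertModule.star_inner])

lemma Adj.op_rsmul (T : Adj A X) (x : X) (a : A) :
    T.op (HilbertModule.rsmul x a) = HilbertModule.rsmul (T.op x) a := by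
  refine hm_ext (A := A) fun z => ?_
  rw [← T.inner_adj, HilbertModule.inner_rsmul_right, HilbertModule.inner_rsmul_right, T.inner_adj]

lemma finRank_mul_left (T : Adj A X) {F : X →L[ℂ] X} (hF : F ∈ finRank A X) :
    T.op * F ∈ finRank A X := by
  induction hF using Submodule.span_induction with
  | mem F h =>
    obtain ⟨ξ, η, rfl⟩ := h
    refine Submodule.subset_span ⟨T.op ξ, η, ?_⟩
    ext ζ
    show T.op (HilbertModule.rankOne A ξ η ζ) = _
    rw [rankOne_apply', rankOne_apply', T.op_rsmul]
  | zero => rw [mul_zero]; exact zero_mem _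
  | add F G _ _ hF hG => rw [mul_add]; exact add_mem hF hG
  | smul c F _ hF => rw [mul_smul_comm]; exact Submodule.smul_mem _ c hF

lemma finRank_mul_right (T : Adj A X) {F : X →L[ℂ] X} (hF : F ∈ finRank A X) :
    F * T.op ∈ finRank A X := by
  induction hF using Submodule.span_induction with
  | mem F h =>
    obtain ⟨ξ, η, rfl⟩ := h
    refine Submodule.subset_span ⟨ξ, T.adj η, ?_⟩
    ext ζ
    show HilbertModule.rankOne A ξ η (T.op ζ) = _
    rw [rankOne_apply', rankOne_apply', T.inner_adj]
  | zero => rw [zero_mul]; exact zero_mem _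
  | add F G _ _ hF hG => rw [add_mul]; exact add_mem hF hG
  | smul c F _ hF => rw [smul_mul_assoc]; exact Submodule.smul_mem _ c hF

end FiniteRank

/-! ### Descending operators to quotients -/

section Descend

variable {A B : Type*} [CStarAlgebra A] [CStarAlgebra B] {I : TwoSidedIdeal A}
  {X Y : Type*} [NormedAddCommGroup X] [NormedSpace ℂ X] [HilbertModule A X]
  [NormedAddCommGroup Y] [NormedSpace ℂ Y] [HilbertModule B Y]

lemma QuotientData.norm_q_le (D : QuotientData A B I X Y) (x : X) : ‖D.q x‖ ≤ ‖x‖ := by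
  refine le_of_sq_le_sq ?_ (norm_nonneg _)
  rw [HilbertModule.norm_sq_inner (A := B), HilbertModule.norm_sq_inner (A := A), D.q_inner]
  exact NonUnitalStarAlgHom.norm_apply_le D.π _

/-- The quotient map as a continuous linear map. -/
def QuotientData.qL (D : QuotientData A B I X Y) : X →L[ℂ] Y :=
  D.q.mkContinuous 1 (fun x => by rw [one_mul]; exact D.norm_q_le x)

lemma QuotientData.q_op_congr (D : QuotientData A B I X Y) (T : Adj A X) {x x' : X}
    (h : D.q x = D.q x') : D.q (T.op x) = D.q (T.op x') := by
  rw [← sub_eq_zero, ← map_sub, ← map_sub]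
  have h0 : D.q (x - x') = 0 := by rw [map_sub, h, sub_self]
  generalize x - x' = z at h0
  apply hm_eq_zero (A := B)
  rw [D.q_inner, T.inner_op, ← D.q_inner, h0, hm_inner_zero_left]

variable [CompleteSpace X] [CompleteSpace Y]

lemma QuotientData.exists_desc (D : QuotientData A B I X Y) (T : Adj A X) :
    ∃ S : Y →L[ℂ] Y, ∀ x, S (D.q x) = D.q (T.op x) := by
  obtain ⟨C, hC0, hC⟩ := D.qL.exists_preimage_norm_le D.q_surjective
  choose s hs hsn using hC
  have hs' : ∀ y, D.q (s y) = y := hs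
  let f : Y →ₗ[ℂ] Y :=
    { toFun := fun y => D.q (T.op (s y))
      map_add' := fun y z => by
        rw [← map_add, ← map_add]
        apply D.q_op_congr
        rw [map_add, hs', hs', hs']
      map_smul' := fun c y => by
        rw [RingHom.id_apply, ← map_smul, ← map_smul]
        apply D.q_op_congr
        rw [map_smul, hs', hs'] }
  refine ⟨f.mkContinuous (‖T.op‖ * C) (fun y => ?_), fun x => ?_⟩
  · calc ‖D.q (T.op (s y))‖ ≤ ‖T.op (s y)‖ := D.norm_q_le _
      _ ≤ ‖T.op‖ * ‖s y‖ := T.op.le_opNorm _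
      _ ≤ ‖T.op‖ * (C * ‖y‖) := by gcongr; exact hsn y
      _ = _ := by ring
  · exact D.q_op_congr T (hs' _)

/-- The descended operator. -/
def QuotientData.desc (D : QuotientData A B I X Y) (T : Adj A X) : Y →L[ℂ] Y :=
  (D.exists_desc T).choose

lemma QuotientData.desc_q (D : QuotientData A B I X Y) (T : Adj A X) (x : X) :
    D.desc T (D.q x) = D.q (T.op x) := (D.exists_desc T).choose_spec x

/-- The descended adjointable operator. -/
def QuotientData.descAdj (D : QuotientData A B I X Y) (T : Adj A X) : Adj B Y :=
  Adj.mk (D.desc T) (D.desc (star T)) (fun y z => by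
    obtain ⟨y, rfl⟩ := D.q_surjective y
    obtain ⟨z, rfl⟩ := D.q_surjective z
    rw [D.desc_q, D.desc_q, D.q_inner, D.q_inner, T.inner_op, Adj.op_star])

@[simp] lemma QuotientData.descAdj_q (D : QuotientData A B I X Y) (T : Adj A X) (x : X) :
    (D.descAdj T).op (D.q x) = D.q (T.op x) := D.desc_q T x

lemma QuotientData.adj_ext (D : QuotientData A B I X Y) {S T : Adj B Y}
    (h : ∀ x, S.op (D.q x) = T.op (D.q x)) : S = T := by
  refine Adj.ext fun y => ?_
  obtain ⟨y, rfl⟩ := D.q_surjective y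
  exact h y

/-- `[·]_I` as a star homomorphism. -/
def QuotientData.rho (D : QuotientData A B I X Y) : Adj A X →⋆ₐ[ℂ] Adj B Y where
  toFun := D.descAdj
  map_one' := D.adj_ext fun x => by simp
  map_mul' S T := D.adj_ext fun x => by simp
  map_zero' := D.adj_ext fun x => by simp
  map_add' S T := D.adj_ext fun x => by simp
  commutes' c := D.adj_ext fun x => by simp
  map_star' T := rfl

@[simp] lemma QuotientData.rho_q (D : QuotientData A B I X Y) (T : Adj A X) (x : X) :
    (D.rho T).op (D.q x) = D.q (T.op x) := D.desc_q T x

lemma QuotientData.clm_ext (D : QuotientData A B I X Y) {S T : Y →L[ℂ] Y}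
    (h : ∀ x, S (D.q x) = T (D.q x)) : S = T := by
  refine ContinuousLinearMap.ext fun y => ?_
  obtain ⟨y, rfl⟩ := D.q_surjective y
  exact h y

lemma QuotientData.rho_finRank (D : QuotientData A B I X Y) {F : X →L[ℂ] X}
    (hF : F ∈ finRank A X) : ∃ G ∈ finRank B Y, ∀ x, G (D.q x) = D.q (F x) := by
  induction hF using Submodule.span_induction with
  | mem F h =>
    obtain ⟨ξ, η, rfl⟩ := h
    refine ⟨HilbertModule.rankOne B (D.q ξ) (D.q η), Submodule.subset_span ⟨_, _, rfl⟩, ?_⟩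
    intro x
    rw [rankOne_apply', rankOne_apply', D.q_rsmul, D.q_inner]
  | zero => exact ⟨0, zero_mem _, fun x => by simp⟩
  | add F G _ _ hF hG =>
    obtain ⟨F', hF', e⟩ := hF
    obtain ⟨G', hG', e'⟩ := hG
    exact ⟨F' + G', add_mem hF' hG', fun x => by simp [e, e']⟩
  | smul c F _ hF =>
    obtain ⟨F', hF', e⟩ := hF
    exact ⟨c • F', Submodule.smul_mem _ c hF', fun x => by simp [e]⟩

lemma QuotientData.lift_finRank (D : QuotientData A B I X Y) {F : Y →L[ℂ] Y}
    (hF : F ∈ finRank B Y) : ∃ K : Adj A X, K.op ∈ finRank A X ∧ (D.rho K).op = F := by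
  induction hF using Submodule.span_induction with
  | mem F h =>
    obtain ⟨ξ, η, rfl⟩ := h
    obtain ⟨ξ, rfl⟩ := D.q_surjective ξ
    obtain ⟨η, rfl⟩ := D.q_surjective η
    refine ⟨Adj.theta ξ η, Submodule.subset_span ⟨ξ, η, rfl⟩, D.clm_ext fun x => ?_⟩
    rw [D.rho_q, rankOne_apply', D.q_inner, ← D.q_rsmul]
    rfl
  | zero => exact ⟨0, zero_mem _, by simp⟩
  | add F G _ _ hF hG =>
    obtain ⟨F', hF', e⟩ := hF
    obtain ⟨G', hG', e'⟩ := hG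
    exact ⟨F' + G', add_mem hF' hG', by simp [e, e']⟩
  | smul c F _ hF =>
    obtain ⟨F', hF', e⟩ := hF
    exact ⟨c • F', by rw [Adj.op_smul]; exact Submodule.smul_mem _ c hF', by simp [e]⟩

lemma QuotientData.apx_of_compacts (D : QuotientData A B I X Y) (T : Adj A X)
    (h : (D.rho T).op ∈ HilbertModule.compacts B Y) :
    Apx {S : Adj A X | S.op ∈ finRank A X} D.rho T := by
  intro ε hε
  obtain ⟨F, hF, hd⟩ := Metric.mem_closure_iff.1 h ε hε
  obtain ⟨K, hK, hKF⟩ := D.lift_finRank (F := F) hF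
  refine ⟨K, hK, ?_⟩
  rw [map_sub, Adj.norm_eq_op, Adj.op_sub, hKF, ← dist_eq_norm]
  exact hd.le

lemma QuotientData.compacts_of_apx (D : QuotientData A B I X Y) (T : Adj A X)
    (h : Apx {S : Adj A X | S.op ∈ finRank A X} D.rho T) :
    (D.rho T).op ∈ HilbertModule.compacts B Y := by
  refine Metric.mem_closure_iff.2 fun ε hε => ?_
  obtain ⟨K, hK, hd⟩ := h (ε / 2) (by positivity)
  obtain ⟨G, hG, e⟩ := D.rho_finRank (F := K.op) hK
  have hG' : (D.rho K).op = G := D.clm_ext fun x => by rw [D.rho_q, e]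
  refine ⟨G, hG, ?_⟩
  rw [dist_eq_norm, ← hG', ← Adj.op_sub, ← Adj.norm_eq_op, ← map_sub]
  linarith

end Descend

lemma norm_pi_le {A B₁ B₂ C : Type*} [CStarAlgebra A] [CStarAlgebra B₁]
    [CStarAlgebra B₂] [CStarAlgebra C] (π₁ : A →⋆ₐ[ℂ] B₁) (π₂ : A →⋆ₐ[ℂ] B₂) (π : A →⋆ₐ[ℂ] C)
    (hs : Function.Surjective π) (h : ∀ a, π a = 0 ↔ π₁ a = 0 ∧ π₂ a = 0) (a : A) :
    ‖π a‖ = max ‖π₁ a‖ ‖π₂ a‖ := by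
  have key : ∀ x y, π x = π y → (π₁ x, π₂ x) = (π₁ y, π₂ y) := by
    intro x y hxy
    have := (h (x - y)).1 (by rw [map_sub, hxy, sub_self])
    rw [map_sub, map_sub, sub_eq_zero, sub_eq_zero] at this
    exact Prod.ext this.1 this.2
  have hs' := Function.surjInv_eq hs
  let s := Function.surjInv hs
  let f : C →⋆ₙₐ[ℂ] (B₁ × B₂) :=
    { toFun := fun c => (π₁ (s c), π₂ (s c))
      map_smul' := fun c x => by
        refine (key _ (c • s x) ?_).trans (by simp)
        rw [map_smul, hs', hs']
      map_zero' := (key _ 0 (by rw [hs', map_zero])).trans (by simp)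
      map_add' := fun x y => by
        refine (key _ (s x + s y) ?_).trans (by simp)
        rw [map_add, hs', hs', hs']
      map_mul' := fun x y => by
        refine (key _ (s x * s y) ?_).trans (by simp)
        rw [map_mul, hs', hs', hs']
      map_star' := fun x => by
        refine (key _ (star (s x)) ?_).trans (by simp [map_star]; rfl)
        rw [map_star, hs', hs'] }
  have hf : ∀ a, f (π a) = (π₁ a, π₂ a) := fun a => key _ _ (hs' _)
  have hinj : Function.Injective f := by
    rw [injective_iff_map_eq_zero]
    intro c hc
    obtain ⟨a, rfl⟩ := hs c
    rw [hf] at hc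
    exact (h a).2 ⟨congrArg Prod.fst hc, congrArg Prod.snd hc⟩
  rw [← NonUnitalStarAlgHom.norm_map f hinj, hf]
  rfl

/-- `φ_X(a)` as an adjointable operator. -/
def Adj.phi {A : Type*} [CStarAlgebra A] {X : Type*}
    [NormedAddCommGroup X] [NormedSpace ℂ X] [Correspondence A X] (a : A) : Adj A X :=
  Adj.mk (Correspondence.lact A a) (Correspondence.lact A (star a))
    (fun x y => Correspondence.inner_lsmul_left a x y)

lemma Adj.phi_apply {A : Type*} [CStarAlgebra A] {X : Type*}
    [NormedAddCommGroup X] [NormedSpace ℂ X] [Correspondence A X] (a : A) (x : X) :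
    (Adj.phi (X := X) a).op x = Correspondence.lsmul a x := rfl

open HilbertModule Correspondence in
/-- `J(I₁) ∩ J(I₂) ⊂ J(I₁ ∩ I₂)`. -/
theorem stmt14 {A B₁ B₂ C : Type*} [CStarAlgebra A] [CStarAlgebra B₁]
    [CStarAlgebra B₂] [CStarAlgebra C]
    {X Y₁ Y₂ Z : Type*} [NormedAddCommGroup X] [NormedSpace ℂ X] [Correspondence A X]
    [NormedAddCommGroup Y₁] [NormedSpace ℂ Y₁] [HilbertModule B₁ Y₁]
    [NormedAddCommGroup Y₂] [NormedSpace ℂ Y₂] [HilbertModule B₂ Y₂]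
    [NormedAddCommGroup Z] [NormedSpace ℂ Z] [HilbertModule C Z]
    [CompleteSpace X] [CompleteSpace Y₁] [CompleteSpace Y₂] [CompleteSpace Z]
    (I₁ I₂ : TwoSidedIdeal A)
    (hI₁ : IsClosed (I₁ : Set A)) (hI₂ : IsClosed (I₂ : Set A))
    (D₁ : QuotientData A B₁ I₁ X Y₁)        -- `Y₁ = X_{I₁}`
    (D₂ : QuotientData A B₂ I₂ X Y₂)        -- `Y₂ = X_{I₂}`
    (D : QuotientData A C (I₁ ⊓ I₂) X Z) :  -- `Z = X_{I₁∩I₂}`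
    JofI D₁ ∩ JofI D₂ ⊆ JofI D := by
  rintro a ⟨⟨⟨T₁, hT₁, e₁⟩, hb₁⟩, ⟨⟨T₂, hT₂, e₂⟩, hb₂⟩⟩
  have hq : ∀ x : X, ‖D.q x‖ = max ‖D₁.q x‖ ‖D₂.q x‖ := by
    intro x
    have h := norm_pi_le D₁.π D₂.π D.π D.π_surjective
      (fun a => by rw [D.π_ker, D₁.π_ker, D₂.π_ker]; exact TwoSidedIdeal.mem_inf A)
      (HilbertModule.inner (A := A) x x)
    rw [← D.q_inner, ← D₁.q_inner, ← D₂.q_inner, ← HilbertModule.norm_sq_inner,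
      ← HilbertModule.norm_sq_inner, ← HilbertModule.norm_sq_inner] at h
    have h0 := norm_nonneg (D.q x)
    have h1 := norm_nonneg (D₁.q x)
    have h2 := norm_nonneg (D₂.q x)
    rcases le_total ‖D₁.q x‖ ‖D₂.q x‖ with hle | hle
    · rw [max_eq_right hle]
      rw [max_eq_right (by gcongr)] at h
      exact (sq_eq_sq₀ h0 h2).1 h
    · rw [max_eq_left hle]
      rw [max_eq_left (by gcongr)] at h
      exact (sq_eq_sq₀ h0 h1).1 h
  have hρ : ∀ (w : Adj A X) (c : ℝ), ‖D₁.rho w‖ ≤ c → ‖D₂.rho w‖ ≤ c → ‖D.rho w‖ ≤ c := by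
    intro w c h1 h2
    rw [Adj.norm_eq_op] at h1 h2 ⊢
    have hc : 0 ≤ c := (norm_nonneg _).trans h1
    refine ContinuousLinearMap.opNorm_le_bound _ hc fun z => ?_
    obtain ⟨x, rfl⟩ := D.q_surjective z
    rw [D.rho_q, hq]
    refine max_le ?_ ?_
    · rw [← D₁.rho_q]
      refine ((D₁.rho w).op.le_opNorm _).trans ?_
      have : ‖D₁.q x‖ ≤ ‖D.q x‖ := by rw [hq]; exact le_max_left _ _
      gcongr
    · rw [← D₂.rho_q]
      refine ((D₂.rho w).op.le_opNorm _).trans ?_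
      have : ‖D₂.q x‖ ≤ ‖D.q x‖ := by rw [hq]; exact le_max_right _ _
      gcongr
  refine ⟨⟨(D.rho (Adj.phi a)).op, ?_, fun ξ => D.rho_q _ ξ⟩, ?_⟩
  · have c₁ : (D₁.rho (Adj.phi a)).op = T₁ := D₁.clm_ext fun x => by rw [D₁.rho_q, e₁]; rfl
    have c₂ : (D₂.rho (Adj.phi a)).op = T₂ := D₂.clm_ext fun x => by rw [D₂.rho_q, e₂]; rfl
    apply D.compacts_of_apx
    refine apx_glue ?_ ?_ ?_ D₁.rho D₂.rho D.rho hρ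
      (D₁.apx_of_compacts _ (by rw [c₁]; exact hT₁)) (D₂.apx_of_compacts _ (by rw [c₂]; exact hT₂))
    · intro f hf g hg
      exact (finRank A X).add_mem hf hg
    · intro f hf m
      exact finRank_mul_left m hf
    · intro f hf m
      exact finRank_mul_right m hf
  · intro b hb
    refine (TwoSidedIdeal.mem_inf A).2 ⟨hb₁ b fun ξ η => ?_, hb₂ b fun ξ η => ?_⟩
    · exact ((TwoSidedIdeal.mem_inf A).1 (hb ξ η)).1
    · exact ((TwoSidedIdeal.mem_inf A).1 (hb ξ η)).2
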